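/- arXiv:1905.01532 — 2 statements merged into one kernel-verified Lean document; each statement's English description precedes it below -/
import Mathlib

section
/- The maximal ideal space 𝔐(H^∞(𝔻 × ℕ)) can be covered by the interiors of two compact subsets, each of which is homeomorphic to a subset of 𝔐(H^∞(𝔻)). -/
open Set Metric WeakDual BoundedContinuousFunction Manifold Topology Complex

set_option synthInstance.maxHeartbeats 1000000
set_option maxHeartbeats 2000000

noncomputable section

/-- The covering dimension of a topological space `X` is at most `n`: every open cover
has an open refinement of order at most `n + 1`. -/
def CovDimLE (X : Type) [TopologicalSpace X] (n : ℕ) : Prop :=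
  ∀ 𝒰 : Set (Set X), (∀ U ∈ 𝒰, IsOpen U) → ⋃₀ 𝒰 = Set.univ →
    ∃ 𝒱 : Set (Set X), (∀ V ∈ 𝒱, IsOpen V) ∧ ⋃₀ 𝒱 = Set.univ ∧
      (∀ V ∈ 𝒱, ∃ U ∈ 𝒰, V ⊆ U) ∧
      ∀ x : X, {V ∈ 𝒱 | x ∈ V}.Finite ∧ {V ∈ 𝒱 | x ∈ V}.ncard ≤ n + 1

/-- `dim X = n`: the covering dimension of `X` is at most `n` but not at most `n - 1`. -/
def CovDimEq (X : Type) [TopologicalSpace X] (n : ℕ) : Prop :=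
  CovDimLE X n ∧ ¬ CovDimLE X (n - 1)

/-- A Čech 2-cocycle (with coefficients in `ℤ`) on the open cover `U` of `X`. -/
def IsCechTwoCocycle {X : Type} [TopologicalSpace X] {ι : Type}
    (U : ι → Set X) (c : ι → ι → ι → ℤ) : Prop :=
  ∀ i j k l : ι, (U i ∩ U j ∩ U k ∩ U l).Nonempty →
    c j k l - c i k l + c i j l - c i j k = 0

/-- Triviality of the second Čech cohomology group `H²(X, ℤ)`: every integral 2-cocycle on
every open cover of `X` becomes a coboundary after passing to a suitable open refinement. -/
def CechH2Trivial (X : Type) [TopologicalSpace X] : Prop :=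
  ∀ (ι : Type) (U : ι → Set X), (∀ i, IsOpen (U i)) → (⋃ i, U i) = Set.univ →
    ∀ c : ι → ι → ι → ℤ, IsCechTwoCocycle U c →
      ∃ (κ : Type) (V : κ → Set X) (τ : κ → ι),
        (∀ j, IsOpen (V j)) ∧ (⋃ j, V j) = Set.univ ∧ (∀ j, V j ⊆ U (τ j)) ∧
        ∃ b : κ → κ → ℤ, ∀ i j k : κ, (V i ∩ V j ∩ V k).Nonempty →
          c (τ i) (τ j) (τ k) = b j k - b i k + b i j

/-- The Banach algebra `H^∞(D)` of bounded holomorphic functions on a set `D ⊆ ℂ`,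
realized as a subalgebra of the bounded continuous functions on `D`. -/
def Hinf (D : Set ℂ) : Subalgebra ℂ (D →ᵇ ℂ) where
  carrier := {f | ∃ g : ℂ → ℂ, DifferentiableOn ℂ g D ∧ ∀ z : D, f z = g z}
  add_mem' := by
    rintro f g ⟨F, hF, hfF⟩ ⟨G, hG, hgG⟩
    exact ⟨F + G, hF.add hG, fun z => by simp [hfF z, hgG z]⟩
  mul_mem' := by
    rintro f g ⟨F, hF, hfF⟩ ⟨G, hG, hgG⟩
    exact ⟨F * G, hF.mul hG, fun z => by simp [hfF z, hgG z]⟩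
  algebraMap_mem' := fun c =>
    ⟨fun _ => c, differentiableOn_const c, fun _ => rfl⟩

/-- The maximal ideal space `𝔐(H^∞(D))` of `H^∞(D)`. -/
abbrev MaxIdealSpace (D : Set ℂ) := characterSpace ℂ (Hinf D)

/-- Evaluation at a point of `D`, as a continuous linear functional on `H^∞(D)`. -/
def HinfEvalCLM (D : Set ℂ) (z : D) : Hinf D →L[ℂ] ℂ :=
  (BoundedContinuousFunction.evalCLM ℂ z).comp
    (Subalgebra.toSubmodule (Hinf D)).subtypeL

lemma HinfEvalCLM_apply (D : Set ℂ) (z : D) (f : Hinf D) :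
    HinfEvalCLM D z f = (f : D →ᵇ ℂ) z := rfl

/-- Evaluation at a point of `D`, as an element of the maximal ideal space of `H^∞(D)`.
This realizes `D` as a subset of `𝔐(H^∞(D))`. -/
def evalChar (D : Set ℂ) (z : D) : MaxIdealSpace D :=
  ⟨HinfEvalCLM D z, by
    constructor
    · intro h
      have h1 : HinfEvalCLM D z 1 = 0 := by rw [h]; rfl
      rw [HinfEvalCLM_apply] at h1
      have h2 : ((1 : Hinf D) : D →ᵇ ℂ) z = (1 : ℂ) := rfl
      rw [h2] at h1
      exact one_ne_zero h1
    · intro f g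
      rfl⟩

/-- The open unit disk in `ℂ`. -/
abbrev unitDisk : Set ℂ := ball (0 : ℂ) 1

/-- `𝔻 × ℕ`: the disjoint union of countably many copies of the open unit disk. -/
abbrev DiskNat := unitDisk × ℕ

/-- The Banach algebra `H^∞(𝔻 × ℕ)` of bounded functions on `𝔻 × ℕ` that are holomorphic on
each copy of `𝔻`, realized as a subalgebra of the bounded continuous functions on `𝔻 × ℕ`. -/
def HinfDiskNat : Subalgebra ℂ (DiskNat →ᵇ ℂ) where
  carrier := {f | ∀ n : ℕ, ∃ g : ℂ → ℂ, DifferentiableOn ℂ g unitDisk ∧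
    ∀ z : unitDisk, f (z, n) = g z}
  add_mem' := by
    rintro f g hf hg n
    obtain ⟨F, hF, hfF⟩ := hf n
    obtain ⟨G, hG, hgG⟩ := hg n
    exact ⟨F + G, hF.add hG, fun z => by simp [hfF z, hgG z]⟩
  mul_mem' := by
    rintro f g hf hg n
    obtain ⟨F, hF, hfF⟩ := hf n
    obtain ⟨G, hG, hgG⟩ := hg n
    exact ⟨F * G, hF.mul hG, fun z => by simp [hfF z, hgG z]⟩
  algebraMap_mem' := fun c n =>
    ⟨fun _ => c, differentiableOn_const c, fun _ => rfl⟩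

/-- The maximal ideal space `𝔐(H^∞(𝔻 × ℕ))`. -/
abbrev MaxIdealSpaceDiskNat := characterSpace ℂ HinfDiskNat

/-! ### Characters of normed algebras -/

/-- A character of a normed algebra is contractive, even if the algebra is not complete. -/
lemma norm_character_apply_le {A : Type*} [NormedRing A] [NormedAlgebra ℂ A]
    (χ : characterSpace ℂ A) (a : A) : ‖χ a‖ ≤ ‖a‖ := by
  by_contra! h
  set L : A →L[ℂ] ℂ := WeakDual.toStrongDual (χ : WeakDual ℂ A) with hL
  have hb : ∀ x : A, ‖χ x‖ ≤ ‖L‖ * ‖x‖ := fun x => L.le_opNorm x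
  have hpos : 0 < ‖χ a‖ := (norm_nonneg a).trans_lt h
  have h1 : ∀ n : ℕ, 1 ≤ ‖L‖ * (‖a‖ / ‖χ a‖) ^ (n + 1) := by
    intro n
    have h2 := hb (a ^ (n + 1))
    rw [map_pow, norm_pow] at h2
    have h3 : ‖χ a‖ ^ (n + 1) ≤ ‖L‖ * ‖a‖ ^ (n + 1) :=
      h2.trans (mul_le_mul_of_nonneg_left (norm_pow_le' a n.succ_pos) (norm_nonneg _))
    rw [div_pow, ← mul_div_assoc, le_div_iff₀ (by positivity), one_mul]
    exact h3
  have hlim : Filter.Tendsto (fun n : ℕ => ‖L‖ * (‖a‖ / ‖χ a‖) ^ (n + 1)) Filter.atTop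
      (𝓝 (‖L‖ * 0)) :=
    ((tendsto_pow_atTop_nhds_zero_of_lt_one (by positivity)
      ((div_lt_one hpos).2 h)).comp (Filter.tendsto_add_atTop_nat 1)).const_mul _
  have := ge_of_tendsto' hlim h1
  norm_num at this

/-- The character space of a normed algebra is compact, even if the algebra is not complete. -/
lemma compactSpace_characterSpace {A : Type*} [NormedRing A] [NormedAlgebra ℂ A] [NormOneClass A] :
    CompactSpace (characterSpace ℂ A) := by
  rw [← isCompact_iff_compactSpace]
  have h : characterSpace ℂ A ⊆ WeakDual.toStrongDual ⁻¹' closedBall 0 1 := by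
    intro φ hφ
    rw [Set.mem_preimage, mem_closedBall_zero_iff]
    refine ContinuousLinearMap.opNorm_le_bound _ zero_le_one fun x => ?_
    rw [one_mul]
    exact norm_character_apply_le (⟨φ, hφ⟩ : characterSpace ℂ A) x
  exact (WeakDual.isCompact_closedBall 0 1).of_isClosed_subset CharacterSpace.isClosed h

/-- The pullback of characters along a continuous algebra homomorphism. -/
def characterPullback {A B : Type*} [NormedRing A] [NormedAlgebra ℂ A] [NormedRing B]
    [NormedAlgebra ℂ B] (φ : A →ₐ[ℂ] B) (hφ : Continuous φ) (χ : characterSpace ℂ B) :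
    characterSpace ℂ A :=
  ⟨(WeakDual.toStrongDual (χ : WeakDual ℂ B)).comp ⟨φ.toLinearMap, hφ⟩, by
    rw [CharacterSpace.eq_set_map_one_map_mul]
    constructor
    · change χ (φ 1) = 1
      rw [map_one, map_one]
    · intro x y
      change χ (φ (x * y)) = χ (φ x) * χ (φ y)
      rw [map_mul, map_mul]⟩

lemma characterPullback_apply {A B : Type*} [NormedRing A] [NormedAlgebra ℂ A] [NormedRing B]
    [NormedAlgebra ℂ B] (φ : A →ₐ[ℂ] B) (hφ : Continuous φ) (χ : characterSpace ℂ B) (a : A) :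
    characterPullback φ hφ χ a = χ (φ a) := rfl

lemma continuous_character_apply {A : Type*} [NormedRing A] [NormedAlgebra ℂ A] (a : A) :
    Continuous fun χ : characterSpace ℂ A => χ a :=
  (WeakDual.eval_continuous a).comp continuous_subtype_val

lemma continuous_characterPullback {A B : Type*} [NormedRing A] [NormedAlgebra ℂ A]
    [NormedRing B] [NormedAlgebra ℂ B] (φ : A →ₐ[ℂ] B) (hφ : Continuous φ) :
    Continuous (characterPullback φ hφ) :=
  Continuous.subtype_mk
    (WeakDual.continuous_of_continuous_eval fun a => continuous_character_apply (φ a)) _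

/-! ### Bounded holomorphic functions on the disk and on `𝔻 × ℕ` -/

/-- A bounded holomorphic function on the disk, as an element of `H^∞(𝔻)`. -/
def hinfOfBound (F : ℂ → ℂ) (hF : DifferentiableOn ℂ F unitDisk) (C : ℝ)
    (hC : ∀ z ∈ unitDisk, ‖F z‖ ≤ C) : Hinf unitDisk :=
  ⟨BoundedContinuousFunction.ofNormedAddCommGroup (fun z : unitDisk => F z)
    hF.continuousOn.domRestrict C fun z => hC z z.2, F, hF, fun _ => rfl⟩

/-- The coordinate function `(z, n) ↦ z` on `𝔻 × ℕ`. -/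
def diskCoord : HinfDiskNat :=
  ⟨BoundedContinuousFunction.ofNormedAddCommGroup (fun p : DiskNat => (p.1 : ℂ))
    (continuous_subtype_val.comp continuous_fst) 1
    fun p => (mem_ball_zero_iff.1 p.1.2).le, fun _ => ⟨id, differentiableOn_id, fun _ => rfl⟩⟩

lemma diskCoord_apply (p : DiskNat) : (diskCoord : DiskNat →ᵇ ℂ) p = p.1 := rfl

lemma norm_character_le_of_forall (χ : MaxIdealSpaceDiskNat) (g : HinfDiskNat) {C : ℝ}
    (hC0 : 0 ≤ C) (hC : ∀ p, ‖(g : DiskNat →ᵇ ℂ) p‖ ≤ C) : ‖χ g‖ ≤ C :=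
  (norm_character_apply_le χ g).trans ((BoundedContinuousFunction.norm_le hC0).2 hC)

lemma neg_mem_unitDisk {z : ℂ} (hz : z ∈ unitDisk) : -z ∈ unitDisk := by
  rwa [mem_ball_zero_iff, norm_neg, ← mem_ball_zero_iff]

/-- Composition with `(z, n) ↦ (-z, n)`, as an endomorphism of `H^∞(𝔻 × ℕ)`. -/
def reflectHom : HinfDiskNat →ₐ[ℂ] HinfDiskNat where
  toFun g := ⟨(g : DiskNat →ᵇ ℂ).compContinuous
      ⟨fun p : DiskNat => (⟨-p.1, neg_mem_unitDisk p.1.2⟩, p.2), by fun_prop⟩, by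
    intro n
    obtain ⟨G, hG, h⟩ := g.2 n
    refine ⟨fun z => G (-z), hG.comp differentiable_neg.differentiableOn ?_, ?_⟩
    · exact fun z hz => neg_mem_unitDisk hz
    · intro z
      exact h ⟨-z, neg_mem_unitDisk z.2⟩⟩
  map_one' := rfl
  map_mul' _ _ := rfl
  map_zero' := rfl
  map_add' _ _ := rfl
  commutes' _ := rfl

lemma reflectHom_reflectHom (g : HinfDiskNat) : reflectHom (reflectHom g) = g := by
  apply Subtype.ext
  ext p
  change (g : DiskNat →ᵇ ℂ) (⟨- -(p.1 : ℂ), _⟩, p.2) = (g : DiskNat →ᵇ ℂ) p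
  congr 2
  exact Subtype.ext (neg_neg _)

lemma reflectHom_diskCoord : reflectHom diskCoord = -diskCoord := rfl

lemma continuous_reflectHom : Continuous reflectHom :=
  AddMonoidHomClass.continuous_of_bound reflectHom 1 fun g => by
    rw [one_mul]
    exact (BoundedContinuousFunction.norm_le (norm_nonneg _)).2 fun p =>
      (g : DiskNat →ᵇ ℂ).norm_coe_le_norm _

/-! ### Parabolic automorphisms of the disk fixing `1` -/

/-- The Cayley transform of the disk onto the half-plane `1 < re v`. -/
def toHalfPlane (z : ℂ) : ℂ := 2 / (1 - z)

lemma norm_sub_two_lt_iff (v : ℂ) : ‖v - 2‖ < ‖v‖ ↔ 1 < v.re := by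
  rw [← sq_lt_sq₀ (norm_nonneg _) (norm_nonneg _), ← normSq_eq_norm_sq, ← normSq_eq_norm_sq,
    normSq_apply, normSq_apply]
  simp only [sub_re, sub_im, re_ofNat, im_ofNat]
  constructor <;> intro h <;> nlinarith

lemma one_sub_ne_zero_of_mem {z : ℂ} (hz : z ∈ unitDisk) : 1 - z ≠ 0 := by
  intro h
  rw [← sub_eq_zero.1 h] at hz
  simp at hz

lemma one_lt_re_toHalfPlane {z : ℂ} (hz : z ∈ unitDisk) : 1 < (toHalfPlane z).re := by
  have h0 := one_sub_ne_zero_of_mem hz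
  rw [← norm_sub_two_lt_iff]
  have h1 : toHalfPlane z - 2 = z * toHalfPlane z := by
    unfold toHalfPlane
    field_simp
    ring
  have h2 : 0 < ‖toHalfPlane z‖ := norm_pos_iff.2 (div_ne_zero two_ne_zero h0)
  rw [h1, norm_mul]
  exact mul_lt_of_lt_one_left h2 (mem_ball_zero_iff.1 hz)

lemma one_sub_two_div_mem {v : ℂ} (hv : 1 < v.re) : 1 - 2 / v ∈ unitDisk := by
  have h0 : v ≠ 0 := by
    rintro rfl
    norm_num at hv
  rw [mem_ball_zero_iff, one_sub_div h0, norm_div, div_lt_one (norm_pos_iff.2 h0)]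
  exact (norm_sub_two_lt_iff v).2 hv

lemma differentiableOn_toHalfPlane : DifferentiableOn ℂ toHalfPlane unitDisk :=
  (differentiableOn_const _).div (by fun_prop) fun _ => one_sub_ne_zero_of_mem

/-- The automorphism of the disk conjugate to `v ↦ v - s * I` on the half-plane. -/
def parabolicShift (s : ℝ) (z : ℂ) : ℂ := 1 - 2 / (toHalfPlane z - s * I)

lemma one_lt_re_toHalfPlane_sub {z : ℂ} (hz : z ∈ unitDisk) (s : ℝ) :
    1 < (toHalfPlane z - s * I).re := by
  simpa using one_lt_re_toHalfPlane hz

lemma toHalfPlane_sub_ne_zero {z : ℂ} (hz : z ∈ unitDisk) (s : ℝ) :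
    toHalfPlane z - s * I ≠ 0 := by
  intro h
  have := one_lt_re_toHalfPlane_sub hz s
  rw [h] at this
  norm_num at this

lemma parabolicShift_mem {z : ℂ} (hz : z ∈ unitDisk) (s : ℝ) :
    parabolicShift s z ∈ unitDisk :=
  one_sub_two_div_mem (one_lt_re_toHalfPlane_sub hz s)

lemma toHalfPlane_parabolicShift {z : ℂ} (hz : z ∈ unitDisk) (s : ℝ) :
    toHalfPlane (parabolicShift s z) = toHalfPlane z - s * I := by
  have h0 := toHalfPlane_sub_ne_zero hz s
  rw [parabolicShift, toHalfPlane, sub_sub_cancel]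
  field_simp

lemma differentiableOn_parabolicShift (s : ℝ) :
    DifferentiableOn ℂ (parabolicShift s) unitDisk :=
  (differentiableOn_const _).sub ((differentiableOn_const _).div
    (differentiableOn_toHalfPlane.sub (differentiableOn_const _))
    fun _ hz => toHalfPlane_sub_ne_zero hz s)

lemma two_div_toHalfPlane (z : ℂ) : 2 / toHalfPlane z = 1 - z := by
  rw [toHalfPlane, div_div_cancel₀ two_ne_zero]

/-- The map `𝔻 × ℕ → 𝔻` moving the `n`-th disk by the shift of height `-8192 n`. -/
def spreadMap : C(DiskNat, unitDisk) where
  toFun p := ⟨parabolicShift (-(8192 * p.2)) p.1, parabolicShift_mem p.1.2 _⟩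
  continuous_toFun := continuous_prod_of_discrete_right.2 fun n =>
    Continuous.subtype_mk
      (differentiableOn_parabolicShift (-(8192 * n))).continuousOn.domRestrict _

/-- Composition with `spreadMap`, as a homomorphism `H^∞(𝔻) → H^∞(𝔻 × ℕ)`. -/
def spreadHom : Hinf unitDisk →ₐ[ℂ] HinfDiskNat where
  toFun f := ⟨(f : unitDisk →ᵇ ℂ).compContinuous spreadMap, by
    intro n
    obtain ⟨F, hF, h⟩ := f.2
    exact ⟨fun z => F (parabolicShift (-(8192 * n)) z),
      hF.comp (differentiableOn_parabolicShift _) fun z hz => parabolicShift_mem hz _,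
      fun z => h _⟩⟩
  map_one' := rfl
  map_mul' _ _ := rfl
  map_zero' := rfl
  map_add' _ _ := rfl
  commutes' _ := rfl

lemma continuous_spreadHom : Continuous spreadHom :=
  AddMonoidHomClass.continuous_of_bound spreadHom 1 fun f => by
    rw [one_mul]
    exact (BoundedContinuousFunction.norm_le (norm_nonneg _)).2 fun p =>
      (f : unitDisk →ᵇ ℂ).norm_coe_le_norm _

/-! ### Series estimates -/

/-- A summable weight on the integers. -/
def intWeight (j : ℤ) : ℝ := (1 / (1 + |(j : ℝ)|)) ^ 2

lemma summable_intWeight : Summable intWeight := by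
  have h : Summable fun n : ℕ => (1 / (1 + (n : ℝ))) ^ 2 := by
    have := (summable_nat_add_iff 1).2 (Real.summable_one_div_nat_pow.2 one_lt_two)
    refine this.congr fun n => ?_
    rw [div_pow, one_pow, Nat.cast_add, Nat.cast_one, add_comm]
  refine Summable.of_nat_of_neg ?_ ?_ <;> refine h.congr fun n => ?_ <;> simp [intWeight]

lemma summable_intWeight_sub (m₀ : ℤ) : Summable fun m : ℕ => intWeight (m - m₀) :=
  summable_intWeight.comp_injective fun a b h => by simpa using h

lemma tsum_intWeight_sub_le (m₀ : ℤ) :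
    ∑' m : ℕ, intWeight (m - m₀) ≤ ∑' j, intWeight j :=
  Summable.tsum_le_tsum_of_inj (fun m : ℕ => (m : ℤ) - m₀) (fun a b h => by simpa using h)
    (fun _ _ => sq_nonneg _) (fun _ => le_rfl) (summable_intWeight_sub m₀) summable_intWeight

lemma norm_two_div_pow_le {x : ℂ} {c : ℝ} (hc : 0 < c) {j : ℤ}
    (hx : c * (1 + |(j : ℝ)|) ≤ ‖x‖) {k : ℕ} (hk : 2 ≤ k) :
    ‖(2 / x) ^ k‖ ≤ (2 / c) ^ k * intWeight j := by
  have hj : (0 : ℝ) < 1 + |(j : ℝ)| := by positivity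
  have h1 : ‖2 / x‖ ≤ 2 / c * (1 / (1 + |(j : ℝ)|)) := by
    rw [norm_div, Complex.norm_ofNat, div_mul_div_comm, mul_one]
    exact div_le_div_of_nonneg_left zero_le_two (by positivity) hx
  rw [norm_pow]
  calc ‖2 / x‖ ^ k ≤ (2 / c * (1 / (1 + |(j : ℝ)|))) ^ k := by gcongr
    _ = (2 / c) ^ k * (1 / (1 + |(j : ℝ)|)) ^ k := mul_pow _ _ _
    _ ≤ (2 / c) ^ k * intWeight j := by
      refine mul_le_mul_of_nonneg_left ?_ (by positivity)
      refine pow_le_pow_of_le_one (by positivity) ?_ hk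
      rw [div_le_one hj]
      linarith [abs_nonneg (j : ℝ)]

lemma one_add_abs_le_norm_sub {v : ℂ} (hv : 1 < v.re) {m m₀ : ℤ}
    (h : |v.im - 8192 * m₀| ≤ 8192) :
    1 / 3 * (1 + |((m - m₀ : ℤ) : ℝ)|) ≤ ‖v - (8192 * m : ℝ) * I‖ := by
  have h1 : 1 < ‖v - (8192 * m : ℝ) * I‖ := by
    refine lt_of_lt_of_le ?_ (re_le_norm _)
    simpa using hv
  have h2 : |v.im - 8192 * m| ≤ ‖v - (8192 * m : ℝ) * I‖ := by
    refine le_trans (le_of_eq ?_) (abs_im_le_norm _)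
    simp
  rw [Int.cast_sub]
  rcases abs_cases ((m : ℝ) - m₀) with h3 | h3 <;> rw [h3.1] <;>
    rw [abs_le] at h h2 <;> by_contra! h4 <;> linarith

lemma one_add_abs_le_norm_sub_of_norm_le {v : ℂ} (hv : ‖v‖ ≤ 8) {j : ℤ} (hj : j ≠ 0) :
    2048 * (1 + |(j : ℝ)|) ≤ ‖v - (8192 * j : ℝ) * I‖ := by
  have h1 : (1 : ℝ) ≤ |(j : ℝ)| := by exact_mod_cast Int.one_le_abs hj
  have h2 : ‖((8192 * j : ℝ) : ℂ) * I‖ = 8192 * |(j : ℝ)| := by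
    rw [norm_mul, norm_I, mul_one, Complex.norm_real, Real.norm_eq_abs, abs_mul]
    norm_num
  have h3 := norm_sub_norm_le (((8192 * j : ℝ) : ℂ) * I) v
  rw [norm_sub_rev, h2] at h3
  linarith

/-- The sum of the functions `(g m) * (1 - z) ^ k`, each transplanted by a shift. -/
def spreadSum (G : ℕ → ℂ → ℂ) (k : ℕ) (z : ℂ) : ℂ :=
  ∑' m : ℕ, G m (1 - 2 / (toHalfPlane z - (8192 * (m : ℤ) : ℝ) * I)) *
    (2 / (toHalfPlane z - (8192 * (m : ℤ) : ℝ) * I)) ^ k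

section SpreadSum

variable {G : ℕ → ℂ → ℂ} {C : ℝ} {k : ℕ}

lemma norm_spreadSum_term_le (hC : ∀ m, ∀ z ∈ unitDisk, ‖G m z‖ ≤ C) (hk : 2 ≤ k)
    {z : ℂ} (hz : z ∈ unitDisk) {m₀ : ℤ} (h : |(toHalfPlane z).im - 8192 * m₀| ≤ 8192) (m : ℕ) :
    ‖G m (1 - 2 / (toHalfPlane z - (8192 * (m : ℤ) : ℝ) * I)) *
      (2 / (toHalfPlane z - (8192 * (m : ℤ) : ℝ) * I)) ^ k‖ ≤
      C * (6 ^ k * intWeight (m - m₀)) := by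
  have h1 := norm_two_div_pow_le (by norm_num)
    (one_add_abs_le_norm_sub (one_lt_re_toHalfPlane hz) h (m := m)) hk
  have h6 : (2 : ℝ) / (1 / 3) = 6 := by norm_num
  rw [h6] at h1
  have h2 := hC m _ (one_sub_two_div_mem (one_lt_re_toHalfPlane_sub hz (8192 * (m : ℤ))))
  rw [norm_mul]
  exact mul_le_mul h2 h1 (norm_nonneg _) ((norm_nonneg _).trans h2)

lemma exists_int_abs_sub_lt (y : ℝ) : ∃ m₀ : ℤ, |y - 8192 * m₀| < 8192 := by
  refine ⟨round (y / 8192), ?_⟩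
  have h := abs_sub_round (y / 8192)
  rw [abs_le] at h
  rw [abs_lt]
  constructor <;> linarith [h.1, h.2]

lemma summable_spreadSum_bound (C : ℝ) (k : ℕ) (m₀ : ℤ) :
    Summable fun m : ℕ => C * (6 ^ k * intWeight (m - m₀)) :=
  ((summable_intWeight_sub m₀).mul_left _).mul_left _

lemma differentiableOn_spreadSum (hG : ∀ m, DifferentiableOn ℂ (G m) unitDisk)
    (hC : ∀ m, ∀ z ∈ unitDisk, ‖G m z‖ ≤ C) (hk : 2 ≤ k) :
    DifferentiableOn ℂ (spreadSum G k) unitDisk := by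
  intro z₀ hz₀
  obtain ⟨m₀, hm₀⟩ := exists_int_abs_sub_lt (toHalfPlane z₀).im
  set U : Set ℂ := unitDisk ∩ toHalfPlane ⁻¹' {v | |v.im - 8192 * m₀| < 8192} with hUdef
  have hU : IsOpen U := differentiableOn_toHalfPlane.continuousOn.isOpen_inter_preimage
    isOpen_ball (isOpen_lt (by fun_prop) continuous_const)
  have hd : DifferentiableOn ℂ (spreadSum G k) U := by
    refine Complex.differentiableOn_tsum_of_summable_norm (summable_spreadSum_bound C k m₀)
      (fun m => ?_) hU fun m z hz => norm_spreadSum_term_le hC hk hz.1 (le_of_lt hz.2) m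
    have hdiv : DifferentiableOn ℂ
        (fun z => 2 / (toHalfPlane z - (8192 * (m : ℤ) : ℝ) * I)) unitDisk :=
      (differentiableOn_const _).div
        (differentiableOn_toHalfPlane.sub (differentiableOn_const _))
        fun _ hz => toHalfPlane_sub_ne_zero hz _
    exact (((hG m).comp (differentiableOn_parabolicShift _)
      fun z hz => parabolicShift_mem hz _).mul (hdiv.pow k)).mono inter_subset_left
  exact (hd.differentiableAt (hU.mem_nhds ⟨hz₀, hm₀⟩)).differentiableWithinAt

lemma tsum_spreadSum_bound_le (hC0 : 0 ≤ C) (c : ℝ) (hc : 0 ≤ c) (m₀ : ℤ) :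
    ∑' m : ℕ, C * (c * intWeight (m - m₀)) ≤ C * (c * ∑' j, intWeight j) := by
  rw [tsum_mul_left, tsum_mul_left]
  gcongr
  exact tsum_intWeight_sub_le m₀

lemma norm_spreadSum_le (hC0 : 0 ≤ C) (hC : ∀ m, ∀ z ∈ unitDisk, ‖G m z‖ ≤ C) (hk : 2 ≤ k)
    {z : ℂ} (hz : z ∈ unitDisk) : ‖spreadSum G k z‖ ≤ C * (6 ^ k * ∑' j, intWeight j) := by
  obtain ⟨m₀, hm₀⟩ := exists_int_abs_sub_lt (toHalfPlane z).im
  exact (tsum_of_norm_bounded (summable_spreadSum_bound C k m₀).hasSum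
    (norm_spreadSum_term_le hC hk hz hm₀.le)).trans
      (tsum_spreadSum_bound_le hC0 _ (by positivity) m₀)

lemma norm_spreadSum_shift_sub_le (hC0 : 0 ≤ C) (hC : ∀ m, ∀ z ∈ unitDisk, ‖G m z‖ ≤ C)
    (hk : 2 ≤ k) {z : ℂ} (hz : z ∈ unitDisk) (n : ℕ) :
    ‖spreadSum G k (parabolicShift (-(8192 * n)) z) - G n z * (1 - z) ^ k‖ *
      ‖1 - z‖ ^ (4 * k) ≤ C * (∑' j, intWeight j) * (3 / 128) ^ k := by
  set w := parabolicShift (-(8192 * n)) z with hw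
  have hwmem : w ∈ unitDisk := parabolicShift_mem hz _
  have hV : toHalfPlane w = toHalfPlane z + 8192 * n * I := by
    rw [hw, toHalfPlane_parabolicShift hz]
    push_cast
    ring
  have hVm : ∀ m : ℕ, toHalfPlane w - (8192 * (m : ℤ) : ℝ) * I =
      toHalfPlane z - (8192 * ((m - n : ℤ) : ℤ) : ℝ) * I := by
    intro m
    rw [hV]
    push_cast
    ring
  set S := ∑' j, intWeight j with hS
  have hS0 : 0 ≤ S := tsum_nonneg fun _ => sq_nonneg _
  set T : ℕ → ℂ := fun m => G m (1 - 2 / (toHalfPlane w - (8192 * (m : ℤ) : ℝ) * I)) *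
    (2 / (toHalfPlane w - (8192 * (m : ℤ) : ℝ) * I)) ^ k with hT
  obtain ⟨m₀, hm₀⟩ := exists_int_abs_sub_lt (toHalfPlane w).im
  have hTle := norm_spreadSum_term_le hC hk hwmem hm₀.le
  have hTsum : Summable T := Summable.of_norm_bounded (summable_spreadSum_bound C k m₀) hTle
  have hTn : T n = G n z * (1 - z) ^ k := by
    have h0 : toHalfPlane w - (8192 * (n : ℤ) : ℝ) * I = toHalfPlane z := by
      rw [hVm]
      simp
    simp only [hT]
    rw [h0, two_div_toHalfPlane, sub_sub_cancel]
  have herr : spreadSum G k w - G n z * (1 - z) ^ k = ∑' m, if m = n then 0 else T m := by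
    rw [← hTn, sub_eq_iff_eq_add']
    exact hTsum.tsum_eq_add_tsum_ite n
  rw [herr]
  rcases le_or_gt (1 / 4) ‖1 - z‖ with hnear | hfar
  · have hVz : ‖toHalfPlane z‖ ≤ 8 := by
      rw [toHalfPlane, norm_div, Complex.norm_ofNat, div_le_iff₀ (by linarith)]
      linarith
    have hterm : ∀ m, ‖if m = n then 0 else T m‖ ≤
        C * ((2 / 2048) ^ k * intWeight (m - n)) := by
      intro m
      split_ifs with hmn
      · rw [norm_zero]
        exact mul_nonneg hC0 (mul_nonneg (by positivity) (sq_nonneg _))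
      · have h1 := norm_two_div_pow_le (by norm_num)
          (one_add_abs_le_norm_sub_of_norm_le hVz (j := m - n) (by omega)) hk
        have h2 := hC m _ (one_sub_two_div_mem
          (one_lt_re_toHalfPlane_sub hwmem (8192 * (m : ℤ))))
        rw [hT, norm_mul]
        refine mul_le_mul h2 ?_ (norm_nonneg _) hC0
        rw [hVm]
        exact h1
    have hsum := (tsum_of_norm_bounded
      (((summable_intWeight_sub n).mul_left _).mul_left _).hasSum hterm).trans
        (tsum_spreadSum_bound_le hC0 _ (by positivity) n)
    have h2 : ‖1 - z‖ ≤ 2 := by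
      have := norm_sub_le 1 z
      have := mem_ball_zero_iff.1 hz
      rw [norm_one] at *
      linarith
    calc _ ≤ C * ((2 / 2048) ^ k * S) * 2 ^ (4 * k) := by gcongr
      _ = C * S * (1 / 64) ^ k := by
        have : (1 / 64 : ℝ) ^ k = (2 / 2048) ^ k * 2 ^ (4 * k) := by
          rw [pow_mul, ← mul_pow]
          norm_num
        rw [this]
        ring
      _ ≤ C * S * (3 / 128) ^ k :=
        mul_le_mul_of_nonneg_left (pow_le_pow_left₀ (by norm_num) (by norm_num) k) (by positivity)
  · have hterm : ∀ m, ‖if m = n then 0 else T m‖ ≤ C * (6 ^ k * intWeight (m - m₀)) := by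
      intro m
      split_ifs with hmn
      · rw [norm_zero]
        exact mul_nonneg hC0 (mul_nonneg (by positivity) (sq_nonneg _))
      · exact hTle m
    have hsum := (tsum_of_norm_bounded (summable_spreadSum_bound C k m₀).hasSum hterm).trans
      (tsum_spreadSum_bound_le hC0 _ (by positivity) m₀)
    calc _ ≤ C * (6 ^ k * S) * (1 / 4) ^ (4 * k) := by gcongr
      _ = C * S * (3 / 128) ^ k := by
        have : (3 / 128 : ℝ) ^ k = 6 ^ k * (1 / 4) ^ (4 * k) := by
          rw [pow_mul, ← mul_pow]
          norm_num
        rw [this]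
        ring

end SpreadSum

/-! ### Separation of characters -/

lemma exists_hinf_spread_approx (g : HinfDiskNat) {k : ℕ} (hk : 2 ≤ k) :
    ∃ f : Hinf unitDisk, ∀ χ : MaxIdealSpaceDiskNat,
      ‖χ (spreadHom f) - χ g * χ (1 - diskCoord) ^ k‖ * ‖χ (1 - diskCoord)‖ ^ (4 * k) ≤
        ‖g‖ * (∑' j, intWeight j) * (3 / 128) ^ k := by
  choose G hG hgG using g.2
  have hC : ∀ m, ∀ z ∈ unitDisk, ‖G m z‖ ≤ ‖g‖ := fun m z hz => by
    rw [← hgG m ⟨z, hz⟩]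
    exact (g : DiskNat →ᵇ ℂ).norm_coe_le_norm _
  have hg0 := norm_nonneg g
  refine ⟨hinfOfBound (spreadSum G k) (differentiableOn_spreadSum hG hC hk) _
    fun z hz => norm_spreadSum_le hg0 hC hk hz, fun χ => ?_⟩
  rw [← map_pow, ← map_mul, ← map_sub, ← norm_pow, ← norm_mul, ← map_pow, ← map_mul]
  have hS0 : 0 ≤ ∑' j, intWeight j := tsum_nonneg fun _ => sq_nonneg _
  refine norm_character_le_of_forall χ _ (by positivity) fun p => ?_
  obtain ⟨z, n⟩ := p
  have h := norm_spreadSum_shift_sub_le hg0 hC hk z.2 n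
  rw [← hgG n z, ← norm_pow, ← norm_mul] at h
  exact h

/-- Characters with `1/2 ≤ ‖χ (1 - z)‖` are separated by the range of `spreadHom`. -/
lemma injOn_characterPullback_spreadHom :
    InjOn (characterPullback spreadHom continuous_spreadHom)
      {χ : MaxIdealSpaceDiskNat | 1 / 2 ≤ ‖χ (1 - diskCoord)‖} := by
  intro χ₁ h₁ χ₂ h₂ heq
  rw [Set.mem_ofPred_eq] at h₁ h₂
  have hagree : ∀ f, χ₁ (spreadHom f) = χ₂ (spreadHom f) := fun f => by
    rw [← characterPullback_apply spreadHom continuous_spreadHom χ₁, heq,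
      characterPullback_apply]
  set a₁ := χ₁ (1 - diskCoord) with ha₁
  set a₂ := χ₂ (1 - diskCoord) with ha₂
  have ha₂0 : a₂ ≠ 0 := by
    intro h
    rw [h, norm_zero] at h₂
    norm_num at h₂
  have improve : ∀ {x a : ℂ} {D : ℝ} {k : ℕ}, 1 / 2 ≤ ‖a‖ →
      ‖x‖ * ‖a‖ ^ (4 * k) ≤ D * (3 / 128) ^ k → ‖x‖ ≤ D * (3 / 8) ^ k := by
    intro x a D k ha h
    have h3 : ‖x‖ * (1 / 2) ^ (4 * k) ≤ D * (3 / 128) ^ k := le_trans (by gcongr) h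
    have h4 : (3 / 128 : ℝ) ^ k = (3 / 8) ^ k * (1 / 2) ^ (4 * k) := by
      rw [pow_mul, ← mul_pow]
      norm_num
    rw [h4, ← mul_assoc] at h3
    exact le_of_mul_le_mul_right h3 (by positivity)
  have key : ∀ g : HinfDiskNat, Filter.Tendsto (fun k : ℕ => (a₁ / a₂) ^ k * χ₁ g)
      Filter.atTop (𝓝 (χ₂ g)) := by
    intro g
    set D := ‖g‖ * ∑' j, intWeight j with hD
    have hlim : Filter.Tendsto (fun k : ℕ => 2 * D * (3 / 4 : ℝ) ^ k) Filter.atTop (𝓝 0) := by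
      simpa using (tendsto_pow_atTop_nhds_zero_of_lt_one (by norm_num : (0 : ℝ) ≤ 3 / 4)
        (by norm_num)).const_mul (2 * D)
    rw [tendsto_iff_norm_sub_tendsto_zero]
    refine squeeze_zero' (Filter.Eventually.of_forall fun _ => norm_nonneg _) ?_ hlim
    filter_upwards [Filter.eventually_ge_atTop 2] with k hk
    obtain ⟨f, hf⟩ := exists_hinf_spread_approx g hk
    have e₁ := improve h₁ (hf χ₁)
    have e₂ := improve h₂ (hf χ₂)
    rw [hagree f] at e₁
    have hdist : ‖χ₁ g * a₁ ^ k - χ₂ g * a₂ ^ k‖ ≤ 2 * D * (3 / 8) ^ k := by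
      have := norm_sub_le (χ₂ (spreadHom f) - χ₂ g * a₂ ^ k) (χ₂ (spreadHom f) - χ₁ g * a₁ ^ k)
      rw [sub_sub_sub_cancel_left] at this
      linarith
    have hid : (a₁ / a₂) ^ k * χ₁ g - χ₂ g = (χ₁ g * a₁ ^ k - χ₂ g * a₂ ^ k) / a₂ ^ k := by
      rw [div_pow]
      field_simp
    rw [hid, norm_div, norm_pow, div_le_iff₀ (by positivity)]
    have hD0 : 0 ≤ D := mul_nonneg (norm_nonneg g) (tsum_nonneg fun _ => sq_nonneg _)
    calc _ ≤ 2 * D * (3 / 8) ^ k := hdist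
      _ = 2 * D * (3 / 4) ^ k * (1 / 2) ^ k := by
        rw [mul_assoc _ _ ((1 / 2 : ℝ) ^ k), ← mul_pow]
        norm_num
      _ ≤ 2 * D * (3 / 4) ^ k * ‖a₂‖ ^ k := by gcongr
  have hone := key 1
  simp only [map_one, mul_one] at hone
  refine CharacterSpace.ext fun g => ?_
  have h := hone.mul_const (χ₁ g)
  rw [one_mul] at h
  exact tendsto_nhds_unique h (key g)

lemma injective_characterPullback_reflectHom :
    Function.Injective (characterPullback reflectHom continuous_reflectHom) := by
  intro χ₁ χ₂ h
  refine CharacterSpace.ext fun g => ?_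
  rw [← reflectHom_reflectHom g, ← characterPullback_apply reflectHom continuous_reflectHom χ₁,
    h, characterPullback_apply]

lemma exists_homeomorph_of_injOn {X Y : Type*} [TopologicalSpace X] [TopologicalSpace Y]
    [T2Space Y] {K : Set X} (hK : IsCompact K) {f : X → Y} (hf : Continuous f)
    (hinj : InjOn f K) : ∃ T : Set Y, Nonempty (K ≃ₜ T) := by
  have := isCompact_iff_compactSpace.1 hK
  have hcont : Continuous (K.domRestrict f) := hf.comp continuous_subtype_val
  exact ⟨_, ⟨(hcont.isClosedEmbedding (injOn_iff_injective.1 hinj)).isEmbedding.toHomeomorph⟩⟩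

/-- `𝔐(H^∞(𝔻 × ℕ))` can be covered by the interiors of two compact subsets,
each homeomorphic to a subset of `𝔐(H^∞(𝔻))`. -/
theorem maxIdealSpace_diskNat_covered_by_two_compacts :
    ∃ K₁ K₂ : Set MaxIdealSpaceDiskNat,
      IsCompact K₁ ∧ IsCompact K₂ ∧
      interior K₁ ∪ interior K₂ = Set.univ ∧
      (∃ T₁ : Set (MaxIdealSpace unitDisk), Nonempty (K₁ ≃ₜ T₁)) ∧
      (∃ T₂ : Set (MaxIdealSpace unitDisk), Nonempty (K₂ ≃ₜ T₂)) := by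
  have : NormOneClass HinfDiskNat := ⟨norm_one (α := DiskNat →ᵇ ℂ)⟩
  have hcompact : CompactSpace MaxIdealSpaceDiskNat := compactSpace_characterSpace
  have hcont (g : HinfDiskNat) : Continuous fun χ : MaxIdealSpaceDiskNat => ‖χ g‖ :=
    (continuous_character_apply g).norm
  have hK (g : HinfDiskNat) : IsCompact {χ : MaxIdealSpaceDiskNat | 1 / 2 ≤ ‖χ g‖} :=
    (isClosed_le continuous_const (hcont g)).isCompact
  have hint (g : HinfDiskNat) : {χ : MaxIdealSpaceDiskNat | 1 / 2 < ‖χ g‖} ⊆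
      interior {χ : MaxIdealSpaceDiskNat | 1 / 2 ≤ ‖χ g‖} :=
    interior_maximal (fun χ (h : 1 / 2 < ‖χ g‖) => h.le) (isOpen_lt continuous_const (hcont g))
  refine ⟨_, _, hK (1 - diskCoord), hK (1 + diskCoord), ?_,
    exists_homeomorph_of_injOn (hK _) (continuous_characterPullback spreadHom continuous_spreadHom)
      injOn_characterPullback_spreadHom,
    exists_homeomorph_of_injOn (hK _)
      ((continuous_characterPullback spreadHom continuous_spreadHom).comp
        (continuous_characterPullback reflectHom continuous_reflectHom))
      (injOn_characterPullback_spreadHom.comp injective_characterPullback_reflectHom.injOn ?_)⟩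
  · refine eq_univ_of_forall fun χ => ?_
    rcases lt_or_ge (1 / 2) ‖χ (1 - diskCoord)‖ with h | h
    · exact Or.inl (hint _ h)
    · refine Or.inr (hint _ ?_)
      have hsum : χ (1 - diskCoord) + χ (1 + diskCoord) = 2 := by
        rw [map_sub, map_add, map_one]
        ring
      have := norm_add_le (χ (1 - diskCoord)) (χ (1 + diskCoord))
      rw [hsum, Complex.norm_ofNat] at this
      rw [Set.mem_ofPred_eq]
      linarith
  · intro χ hχ
    rw [Set.mem_ofPred_eq] at hχ ⊢
    rwa [characterPullback_apply, map_sub, map_one, reflectHom_diskCoord, sub_neg_eq_add]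

end
end

section
/- Let F be a 2×2 matrix with entries in H^∞(𝔻 × ℕ) such that F² = F and F(x) has rank 1 for every x ∈ 𝔻 × ℕ. Then there exists a 2×2 matrix H with entries in H^∞(𝔻 × ℕ), invertible over H^∞(𝔻 × ℕ), such that H⁻¹·F·H = diag(1,0). -/
open Set Metric WeakDual BoundedContinuousFunction Manifold Topology Complex

set_option synthInstance.maxHeartbeats 1000000
set_option maxHeartbeats 2000000

noncomputable section

/-- The matrix of values of a matrix over `H^∞(𝔻 × ℕ)` at a point `x ∈ 𝔻 × ℕ`. -/
def valueMatrixDiskNat (F : Matrix (Fin 2) (Fin 2) HinfDiskNat) (x : DiskNat) :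
    Matrix (Fin 2) (Fin 2) ℂ :=
  Matrix.of fun i j => ((F i j : DiskNat →ᵇ ℂ) x)

theorem exists_differentiableOn_tendsto_ultrafilter {E : Type*} [NormedAddCommGroup E]
    [NormedSpace ℂ E] [ProperSpace E] {ι : Type*} (φ : Ultrafilter ι) {U : Set ℂ} (hU : IsOpen U)
    {f : ι → ℂ → E} {C : ℝ} (hf : ∀ i, DifferentiableOn ℂ (f i) U)
    (hC : ∀ i, ∀ z ∈ U, ‖f i z‖ ≤ C) :
    ∃ g : ℂ → E, DifferentiableOn ℂ g U ∧
      ∀ z ∈ U, Filter.Tendsto (fun i => f i z) φ (𝓝 (g z)) := by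
  have hlim : ∀ z : ℂ, ∃ w : E, z ∈ U → Filter.Tendsto (fun i => f i z) φ (𝓝 w) := by
    intro z
    by_cases hz : z ∈ U
    · obtain ⟨w, -, hw⟩ := (isCompact_closedBall (0 : E) C).ultrafilter_le_nhds
        (φ.map fun i => f i z) (Filter.le_principal_iff.2 <| Filter.mem_map.2 <|
          Filter.Eventually.of_forall fun i => by simpa using hC i z hz)
      exact ⟨w, fun _ => hw⟩
    · exact ⟨0, fun h => absurd h hz⟩
  choose g hg using hlim
  refine ⟨g, TendstoLocallyUniformlyOn.differentiableOn (φ := (φ : Filter ι)) (F := f) ?_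
    (Filter.Eventually.of_forall hf) hU, hg⟩
  rw [Metric.tendstoLocallyUniformlyOn_iff]
  intro ε hε x hx
  obtain ⟨r, hr, hrU⟩ := Metric.isOpen_iff.1 hU x hx
  obtain ⟨i₀, -⟩ := φ.nonempty_of_mem Filter.univ_mem
  have hC0 : 0 ≤ C := (norm_nonneg _).trans (hC i₀ x hx)
  have hlip : ∀ i, ∀ y ∈ ball x r, dist (f i y) (f i x) ≤ 2 * C / r * dist y x := fun i y hy =>
    Complex.dist_le_div_mul_dist_of_mapsTo_ball ((hf i).mono hrU)
      (fun w hw => by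
        rw [mem_closedBall, dist_eq_norm]
        linarith [norm_sub_le (f i w) (f i x), hC i w (hrU hw), hC i x hx]) hy
  have hlipg : ∀ y ∈ ball x r, dist (g y) (g x) ≤ 2 * C / r * dist y x := fun y hy =>
    le_of_tendsto ((hg y (hrU hy)).dist (hg x hx))
      (Filter.Eventually.of_forall fun i => hlip i y hy)
  have hsmall : ∀ᶠ y in 𝓝 x, 2 * C / r * dist y x < ε / 3 := by
    have : Filter.Tendsto (fun y => 2 * C / r * dist y x) (𝓝 x) (𝓝 (2 * C / r * dist x x)) :=
      (continuous_const.mul (continuous_id.dist continuous_const)).tendsto x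
    rw [dist_self, mul_zero] at this
    exact this.eventually_lt_const (by positivity)
  refine ⟨_, mem_nhdsWithin_of_mem_nhds (hsmall.and (ball_mem_nhds x hr)), ?_⟩
  filter_upwards [Metric.tendsto_nhds.1 (hg x hx) (ε / 3) (by positivity)] with i hi y hy
  have h1 := hlip i y hy.2
  have h2 := hlipg y hy.2
  have h3 := hy.1
  rw [dist_comm] at h1 hi
  linarith [dist_triangle4 (g y) (g x) (f i x) (f i y)]

theorem exists_differentiable_re_near_on_sphere {φ : ℂ → ℝ} (hφ : ContinuousOn φ (sphere 0 1))
    {ε : ℝ} (hε : 0 < ε) :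
    ∃ g : ℂ → ℂ, Differentiable ℂ g ∧ ∀ z ∈ sphere (0 : ℂ) 1, |(g z).re - φ z| < ε := by
  have : Fact (0 < (1 : ℝ)) := ⟨one_pos⟩
  let S : Submodule ℂ C(AddCircle (1 : ℝ), ℂ) :=
    { carrier := {f | ∃ g h : ℂ → ℂ, Differentiable ℂ g ∧ Differentiable ℂ h ∧
        ∀ t, f t = g (AddCircle.toCircle t) + (starRingEnd ℂ) (h (AddCircle.toCircle t))}
      zero_mem' := ⟨0, 0, differentiable_const 0, differentiable_const 0, fun t => by simp⟩
      add_mem' := by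
        rintro _ _ ⟨g₁, h₁, hg₁, hh₁, H₁⟩ ⟨g₂, h₂, hg₂, hh₂, H₂⟩
        refine ⟨g₁ + g₂, h₁ + h₂, hg₁.add hg₂, hh₁.add hh₂, fun t => ?_⟩
        simp only [ContinuousMap.add_apply, Pi.add_apply, map_add, H₁, H₂]
        ring
      smul_mem' := by
        rintro c _ ⟨g, h, hg, hh, H⟩
        refine ⟨fun z => c * g z, fun z => (starRingEnd ℂ) c * h z, hg.const_mul _,
          hh.const_mul _, fun t => ?_⟩
        simp only [ContinuousMap.smul_apply, smul_eq_mul, map_mul, H, Complex.conj_conj]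
        ring }
  have hS : Submodule.span ℂ (range (@fourier 1)) ≤ S := by
    rw [Submodule.span_le]
    rintro _ ⟨n, rfl⟩
    obtain ⟨m, rfl | rfl⟩ := n.eq_nat_or_neg
    · exact ⟨fun z => z ^ m, 0, differentiable_id.pow m, differentiable_const 0, fun t => by
        simp [AddCircle.toCircle_nsmul]⟩
    · refine ⟨0, fun z => z ^ m, differentiable_const 0, differentiable_id.pow m, fun t => ?_⟩
      simp [AddCircle.toCircle_nsmul, AddCircle.toCircle_neg, ← Circle.coe_inv_eq_conj]
  have hmem : ∀ t : AddCircle (1 : ℝ), (AddCircle.toCircle t : ℂ) ∈ sphere (0 : ℂ) 1 :=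
    fun t => by simpa using Circle.norm_coe _
  have hcont : Continuous fun t : AddCircle (1 : ℝ) => (φ (AddCircle.toCircle t) : ℂ) :=
    Complex.continuous_ofReal.comp (hφ.comp_continuous
      (continuous_subtype_val.comp AddCircle.continuous_toCircle) hmem)
  have hcl : (⟨_, hcont⟩ : C(AddCircle (1 : ℝ), ℂ)) ∈
      (Submodule.span ℂ (range (@fourier 1))).topologicalClosure := by
    rw [span_fourier_closure_eq_top]; trivial
  obtain ⟨p, hp, hdist⟩ := Metric.mem_closure_iff.1 hcl ε hε
  obtain ⟨g, h, hg, hh, H⟩ := hS hp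
  refine ⟨g + h, hg.add hh, fun z hz => ?_⟩
  obtain ⟨t, ht⟩ := (AddCircle.homeomorphCircle (one_ne_zero (α := ℝ))).surjective
    ⟨z, by simpa [Submonoid.unitSphere] using hz⟩
  rw [AddCircle.homeomorphCircle_apply] at ht
  have hzt : (AddCircle.toCircle t : ℂ) = z := by rw [ht]
  have key := (ContinuousMap.dist_apply_le_dist t).trans_lt hdist
  rw [dist_comm, H, ContinuousMap.coe_mk, dist_eq_norm, hzt] at key
  refine lt_of_eq_of_lt ?_ ((Complex.abs_re_le_norm _).trans_lt key)
  simp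

theorem exists_analyticOnNhd_ne_zero_mulVec_eq {n : Type*} [Fintype n] {U : Set ℂ}
    (hU : IsCompact U) (hUc : IsPreconnected U) (hUn : U.Nontrivial) {A : ℂ → Matrix n n ℂ}
    (hA : ∀ i j, AnalyticOnNhd ℂ (fun z => A z i j) U) (hidem : ∀ z ∈ U, A z * A z = A z)
    (hne : ∀ z ∈ U, A z ≠ 0) :
    ∃ u : ℂ → n → ℂ, AnalyticOnNhd ℂ u U ∧ ∀ z ∈ U, u z ≠ 0 ∧ (A z).mulVec (u z) = u z := by
  obtain ⟨z₀, hz₀⟩ := hUn.nonempty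
  obtain ⟨i₀, j, hij⟩ : ∃ i j, A z₀ i j ≠ 0 := by
    by_contra! h
    exact hne z₀ hz₀ (Matrix.ext h)
  let f : ℂ → n → ℂ := fun z i => A z i j
  have hf : AnalyticOnNhd ℂ f U := fun z hz => AnalyticAt.pi fun i => hA i j z hz
  have hfix : ∀ z ∈ U, (A z).mulVec (f z) = f z := fun z hz => by
    ext i
    simpa [Matrix.mul_apply, Matrix.mulVec, dotProduct] using congrFun₂ (hidem z hz) i j
  have hf₀ : f z₀ ≠ 0 := fun h => hij (congrFun h i₀)
  have hord : ∀ z : U, meromorphicOrderAt f z ≠ ⊤ := fun z =>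
    hf.meromorphicOn.meromorphicOrderAt_ne_top_of_isPreconnected hUc hz₀ z.2 <|
      (meromorphicOrderAt_ne_top_iff_eventually_ne_zero (hf z₀ hz₀).meromorphicAt).2 <|
        ((hf z₀ hz₀).continuousAt.eventually_ne hf₀).filter_mono nhdsWithin_le_nhds
  obtain ⟨g, hg, hg0, hfg⟩ := hf.meromorphicOn.extract_zeros_poles hord
    ((MeromorphicOn.divisor f U).finiteSupport hU)
  refine ⟨g, hg, fun z hz => ⟨hg0 ⟨z, hz⟩, ?_⟩⟩
  have hUp : Preperfect U := hUc.preperfect_of_nontrivial hUn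
  have hacc : (𝓝[≠] z ⊓ Filter.principal U).NeBot := hUp z hz
  set D := MeromorphicOn.divisor f U
  have hφ : MeromorphicAt (∏ᶠ u, (· - u) ^ D u) z :=
    (Function.FactorizedRational.meromorphicNFOn D U hz).meromorphicAt
  have hφ0 : ∀ᶠ w in 𝓝[≠] z, (∏ᶠ u, (· - u) ^ D u) w ≠ 0 :=
    (meromorphicOrderAt_ne_top_iff_eventually_ne_zero hφ).1
      (Function.FactorizedRational.meromorphicOrderAt_ne_top D)
  have hloc := MeromorphicAt.eventuallyEq_nhdsNE_of_eventuallyEq_codiscreteWithin_preperfect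
    (hf z hz).meromorphicAt (hφ.smul (hg z hz).meromorphicAt) hz hUp hfg
  have hev : ∀ᶠ w in 𝓝[≠] z ⊓ Filter.principal U, (A w).mulVec (g w) = g w := by
    filter_upwards [hloc.filter_mono inf_le_left, hφ0.filter_mono inf_le_left,
      Filter.mem_inf_of_right (Filter.mem_principal_self U)] with w hw hw0 hwU
    have h := hfix w hwU
    rw [hw, Pi.smul_apply', Matrix.mulVec_smul] at h
    exact smul_right_injective _ hw0 h
  have hle : 𝓝[≠] z ⊓ Filter.principal U ≤ 𝓝 z := inf_le_left.trans nhdsWithin_le_nhds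
  have hcont : ContinuousAt (fun w => (A w).mulVec (g w)) z := by
    refine continuousAt_pi.2 fun i => ?_
    simp only [Matrix.mulVec, dotProduct]
    exact tendsto_finsetSum _ fun k _ => (hA i k z hz).continuousAt.mul
      ((continuous_apply k).continuousAt.comp (hg z hz).continuousAt)
  exact tendsto_nhds_unique ((hcont.tendsto.mono_left hle).congr' hev)
    ((hg z hz).continuousAt.tendsto.mono_left hle)

theorem mul_eq_dotProduct_mul_of_mulVec_eq {R : Type*} [CommRing R]
    {A : Matrix (Fin 2) (Fin 2) R} (htr : A.trace = 1) {u v : Fin 2 → R} (hu : A.mulVec u = u)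
    (hv : A.transpose.mulVec v = v) (i j : Fin 2) : u i * v j = dotProduct u v * A i j := by
  rw [Matrix.trace_fin_two] at htr
  have hu0 := congrFun hu 0
  have hu1 := congrFun hu 1
  have hv0 := congrFun hv 0
  have hv1 := congrFun hv 1
  simp only [Matrix.mulVec, dotProduct, Fin.sum_univ_two, Matrix.transpose_apply] at hu0 hu1 hv0 hv1
  rw [dotProduct, Fin.sum_univ_two]
  fin_cases i <;> fin_cases j <;> simp only [Fin.zero_eta, Fin.mk_one]
  · linear_combination (-u 0) * hv0 + v 1 * hu1 - u 1 * v 1 * htr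
  · linear_combination (-u 0) * hv1 - v 1 * hu0 + u 0 * v 1 * htr
  · linear_combination (-u 1) * hv0 - v 0 * hu1 + u 1 * v 0 * htr
  · linear_combination v 0 * hu0 - u 1 * hv1 - u 0 * v 0 * htr

theorem exists_bounded_factorization_of_analyticOnNhd_closedBall
    {A : ℂ → Matrix (Fin 2) (Fin 2) ℂ}
    (hA : ∀ i j, AnalyticOnNhd ℂ (fun z => A z i j) (closedBall 0 1))
    (hidem : ∀ z ∈ closedBall (0 : ℂ) 1, A z * A z = A z)
    (htr : ∀ z ∈ closedBall (0 : ℂ) 1, (A z).trace = 1) {M : ℝ}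
    (hM : ∀ z ∈ closedBall (0 : ℂ) 1, ∀ i j, ‖A z i j‖ ≤ M) :
    ∃ u v : ℂ → Fin 2 → ℂ, DifferentiableOn ℂ u (ball 0 1) ∧ DifferentiableOn ℂ v (ball 0 1) ∧
      ∀ z ∈ ball (0 : ℂ) 1, ‖u z‖ ≤ Real.exp 1 ∧ ‖v z‖ ≤ Real.exp 1 * M ∧
        ∀ i j, A z i j = u z i * v z j := by
  have hM0 : 0 ≤ M := (norm_nonneg _).trans (hM 0 (by simp) 0 0)
  have hne : ∀ z ∈ closedBall (0 : ℂ) 1, A z ≠ 0 := fun z hz h => by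
    simpa [h] using htr z hz
  have hcpt : IsCompact (closedBall (0 : ℂ) 1) := isCompact_closedBall 0 1
  have hconn : IsPreconnected (closedBall (0 : ℂ) 1) := (convex_closedBall 0 1).isPreconnected
  have hnt : (closedBall (0 : ℂ) 1).Nontrivial := ⟨0, by simp, 1, by simp, zero_ne_one⟩
  obtain ⟨u, hu, hu'⟩ := exists_analyticOnNhd_ne_zero_mulVec_eq hcpt hconn hnt hA hidem hne
  obtain ⟨v, hv, hv'⟩ := exists_analyticOnNhd_ne_zero_mulVec_eq hcpt hconn hnt
    (A := fun z => (A z).transpose) (fun i j => hA j i)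
    (fun z hz => by rw [← Matrix.transpose_mul, hidem z hz])
    (fun z hz h => hne z hz (Matrix.transpose_eq_zero.1 h))
  have huv : ∀ z ∈ closedBall (0 : ℂ) 1, ∀ i j, u z i * v z j = dotProduct (u z) (v z) * A z i j :=
    fun z hz => mul_eq_dotProduct_mul_of_mulVec_eq (htr z hz) (hu' z hz).2 (hv' z hz).2
  have hdot : ∀ z ∈ closedBall (0 : ℂ) 1, dotProduct (u z) (v z) ≠ 0 := fun z hz h => by
    obtain ⟨i, hi⟩ := Function.ne_iff.1 (hu' z hz).1
    obtain ⟨j, hj⟩ := Function.ne_iff.1 (hv' z hz).1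
    exact mul_ne_zero hi hj (by rw [huv z hz, h, zero_mul])
  have hdiffu : DifferentiableOn ℂ u (closedBall 0 1) := hu.differentiableOn
  have hdiffv : DifferentiableOn ℂ v (closedBall 0 1) := hv.differentiableOn
  have hdiffdot : DifferentiableOn ℂ (fun z => dotProduct (u z) (v z)) (closedBall 0 1) := by
    simp only [dotProduct]
    exact DifferentiableOn.fun_sum fun i _ =>
      (differentiableOn_pi.1 hdiffu i).mul (differentiableOn_pi.1 hdiffv i)
  have hsub : sphere (0 : ℂ) 1 ⊆ closedBall 0 1 := sphere_subset_closedBall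
  obtain ⟨g, hg, hgu⟩ := exists_differentiable_re_near_on_sphere
    (φ := fun z => Real.log ‖u z‖)
    ((hu.continuousOn.mono hsub).norm.log fun z hz => norm_ne_zero_iff.2 (hu' z (hsub hz)).1)
    one_pos
  let p : ℂ → Fin 2 → ℂ := fun z => Complex.exp (-g z) • u z
  let q : ℂ → Fin 2 → ℂ := fun z => (Complex.exp (g z) * (dotProduct (u z) (v z))⁻¹) • v z
  have hp : DifferentiableOn ℂ p (closedBall 0 1) := hg.differentiableOn.neg.cexp.smul hdiffu
  have hq : DifferentiableOn ℂ q (closedBall 0 1) :=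
    (hg.differentiableOn.cexp.mul (hdiffdot.inv hdot)).smul hdiffv
  have hpq : ∀ z ∈ closedBall (0 : ℂ) 1, ∀ i j, A z i j = p z i * q z j := fun z hz i j => by
    simp only [p, q, Pi.smul_apply, smul_eq_mul, Complex.exp_neg]
    have h := huv z hz i j
    have h1 := hdot z hz
    have h2 := Complex.exp_ne_zero (g z)
    field_simp
    linear_combination -h
  have hpn : ∀ z ∈ sphere (0 : ℂ) 1, ‖p z‖ = Real.exp (Real.log ‖u z‖ - (g z).re) := fun z hz => by
    rw [Real.exp_sub, Real.exp_log (norm_pos_iff.2 (hu' z (hsub hz)).1), norm_smul,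
      Complex.norm_exp, Complex.neg_re, Real.exp_neg]
    ring
  have hp1 : ∀ z ∈ sphere (0 : ℂ) 1, ‖p z‖ ≤ Real.exp 1 := fun z hz => by
    rw [hpn z hz, Real.exp_le_exp]
    linarith [(abs_lt.1 (hgu z hz)).1]
  have hp2 : ∀ z ∈ sphere (0 : ℂ) 1, 1 ≤ Real.exp 1 * ‖p z‖ := fun z hz => by
    rw [hpn z hz, ← Real.exp_add, Real.one_le_exp_iff]
    linarith [(abs_lt.1 (hgu z hz)).2]
  have hq1 : ∀ z ∈ sphere (0 : ℂ) 1, ‖q z‖ ≤ Real.exp 1 * M := fun z hz => by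
    refine (pi_norm_le_iff_of_nonneg (by positivity)).2 fun j => ?_
    have hj : ‖p z‖ * ‖q z j‖ ≤ M := by
      rw [mul_comm, ← norm_smul]
      refine (pi_norm_le_iff_of_nonneg hM0).2 fun i => ?_
      rw [Pi.smul_apply, smul_eq_mul, mul_comm, ← hpq z (hsub hz)]
      exact hM z (hsub hz) i j
    calc ‖q z j‖ ≤ Real.exp 1 * ‖p z‖ * ‖q z j‖ :=
          le_mul_of_one_le_left (norm_nonneg _) (hp2 z hz)
      _ ≤ Real.exp 1 * M := by
          rw [mul_assoc]
          exact mul_le_mul_of_nonneg_left hj (Real.exp_pos 1).le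
  have hmax : ∀ {f : ℂ → Fin 2 → ℂ} {C : ℝ}, DifferentiableOn ℂ f (closedBall 0 1) →
      (∀ z ∈ sphere (0 : ℂ) 1, ‖f z‖ ≤ C) → ∀ z ∈ ball (0 : ℂ) 1, ‖f z‖ ≤ C :=
    fun {f C} hf hC z hz => Complex.norm_le_of_forall_mem_frontier_norm_le isBounded_ball
      (DifferentiableOn.diffContOnCl (by rwa [closure_ball _ one_ne_zero]))
      (by rwa [frontier_ball _ one_ne_zero]) (subset_closure hz)
  exact ⟨p, q, hp.mono ball_subset_closedBall, hq.mono ball_subset_closedBall, fun z hz =>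
    ⟨hmax hp hp1 z hz, hmax hq hq1 z hz, hpq z (ball_subset_closedBall hz)⟩⟩

theorem exists_bounded_factorization_on_unitDisk {A : ℂ → Matrix (Fin 2) (Fin 2) ℂ}
    (hA : ∀ i j, DifferentiableOn ℂ (fun z => A z i j) unitDisk)
    (hidem : ∀ z ∈ unitDisk, A z * A z = A z) (htr : ∀ z ∈ unitDisk, (A z).trace = 1) {M : ℝ}
    (hM : ∀ z ∈ unitDisk, ∀ i j, ‖A z i j‖ ≤ M) :
    ∃ u v : ℂ → Fin 2 → ℂ, DifferentiableOn ℂ u unitDisk ∧ DifferentiableOn ℂ v unitDisk ∧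
      ∀ z ∈ unitDisk, ‖u z‖ ≤ Real.exp 1 ∧ ‖v z‖ ≤ Real.exp 1 * M ∧
        ∀ i j, A z i j = u z i * v z j := by
  let r : ℕ → ℝ := fun n => 1 - 1 / ((n : ℝ) + 1)
  have hr0 : ∀ n, 0 ≤ r n := fun n => by
    have : 1 / ((n : ℝ) + 1) ≤ 1 := by
      rw [div_le_one (by positivity)]
      linarith [n.cast_nonneg (α := ℝ)]
    exact sub_nonneg.2 this
  have hr1 : ∀ n, r n < 1 := fun n => sub_lt_self _ (by positivity)
  have hrlim : Filter.Tendsto r Filter.atTop (𝓝 1) := by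
    simpa [r] using tendsto_one_div_add_atTop_nhds_zero_nat.const_sub (1 : ℝ)
  have hmaps : ∀ n, ∀ z ∈ closedBall (0 : ℂ) 1, (r n : ℂ) * z ∈ unitDisk := fun n z hz => by
    rw [mem_ball_zero_iff, norm_mul, Complex.norm_of_nonneg (hr0 n)]
    exact (mul_le_of_le_one_right (hr0 n) (mem_closedBall_zero_iff.1 hz)).trans_lt (hr1 n)
  have hfac := fun n => exists_bounded_factorization_of_analyticOnNhd_closedBall
    (A := fun z => A (r n * z))
    (fun i j z hz => ((hA i j).analyticAt (isOpen_ball.mem_nhds (hmaps n z hz))).comp_of_eq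
      (analyticAt_const.mul analyticAt_id) rfl)
    (fun z hz => hidem _ (hmaps n z hz)) (fun z hz => htr _ (hmaps n z hz))
    (fun z hz => hM _ (hmaps n z hz))
  choose u v hu hv huv using hfac
  obtain ⟨p, hp, hup⟩ := exists_differentiableOn_tendsto_ultrafilter (Filter.hyperfilter ℕ)
    isOpen_ball hu fun n z hz => (huv n z hz).1
  obtain ⟨q, hq, hvq⟩ := exists_differentiableOn_tendsto_ultrafilter (Filter.hyperfilter ℕ)
    isOpen_ball hv fun n z hz => (huv n z hz).2.1
  refine ⟨p, q, hp, hq, fun z hz => ⟨?_, ?_, fun i j => ?_⟩⟩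
  · exact le_of_tendsto (hup z hz).norm (Filter.Eventually.of_forall fun n => (huv n z hz).1)
  · exact le_of_tendsto (hvq z hz).norm (Filter.Eventually.of_forall fun n => (huv n z hz).2.1)
  · have hrz : Filter.Tendsto (fun n => (r n : ℂ) * z) (Filter.hyperfilter ℕ) (𝓝 z) := by
      have h := ((Complex.continuous_ofReal.tendsto 1).comp
        (hrlim.mono_left Nat.hyperfilter_le_atTop)).mul_const z
      simpa [Function.comp_def] using h
    have hAz : Filter.Tendsto (fun n => A (r n * z) i j) (Filter.hyperfilter ℕ) (𝓝 (A z i j)) :=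
      ((hA i j).continuousOn.continuousAt (isOpen_ball.mem_nhds hz)).tendsto.comp hrz
    refine tendsto_nhds_unique hAz ?_
    simp only [fun n => (huv n z hz).2.2 i j]
    exact ((tendsto_pi_nhds.1 (hup z hz)) i).mul ((tendsto_pi_nhds.1 (hvq z hz)) j)

theorem exists_mem_hinfDiskNat {f : ℕ → ℂ → ℂ} (hf : ∀ n, DifferentiableOn ℂ (f n) unitDisk)
    {C : ℝ} (hC : ∀ n, ∀ z ∈ unitDisk, ‖f n z‖ ≤ C) :
    ∃ g : HinfDiskNat, ∀ (z : unitDisk) (n : ℕ), (g : DiskNat →ᵇ ℂ) (z, n) = f n z := by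
  have hcont : Continuous fun x : DiskNat => f x.2 x.1 :=
    continuous_prod_of_discrete_right.2 fun n =>
      (hf n).continuousOn.comp_continuous continuous_subtype_val Subtype.prop
  exact ⟨⟨BoundedContinuousFunction.ofNormedAddCommGroup _ hcont C fun x => hC x.2 x.1 x.1.2,
    fun n => ⟨f n, hf n, fun _ => rfl⟩⟩, fun _ _ => rfl⟩

theorem Matrix.trace_eq_one_of_mul_self_of_rank_eq_one {K : Type*} [Field K]
    {A : Matrix (Fin 2) (Fin 2) K} (hA : A * A = A) (hr : A.rank = 1) : A.trace = 1 := by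
  have hdet : A.det = 0 := by
    by_contra h
    have := Matrix.rank_of_isUnit A ((Matrix.isUnit_iff_isUnit_det A).2 (isUnit_iff_ne_zero.2 h))
    simp [hr] at this
  have hne : A ≠ 0 := by
    rintro rfl
    simp at hr
  by_contra htr
  have key : ∀ i j, (1 - A.trace) * A i j = 0 := by
    have h := fun i j => congrFun₂ hA i j
    simp only [Matrix.mul_apply, Fin.sum_univ_two] at h
    rw [Matrix.det_fin_two] at hdet
    rw [Matrix.trace_fin_two]
    intro i j
    fin_cases i <;> fin_cases j <;> simp only [Fin.zero_eta, Fin.mk_one]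
    · linear_combination -h 0 0 - hdet
    · linear_combination -h 0 1
    · linear_combination -h 1 0
    · linear_combination -h 1 1 - hdet
  exact hne (Matrix.ext fun i j =>
    (mul_eq_zero.1 (key i j)).resolve_left (sub_ne_zero.2 (Ne.symm htr)))

theorem exists_similar_diagonal_of_eq_mul {R : Type*} [CommRing R]
    {F : Matrix (Fin 2) (Fin 2) R} (u v : Fin 2 → R) (hF : ∀ i j, F i j = u i * v j)
    (huv : u 0 * v 0 + u 1 * v 1 = 1) :
    ∃ H K : Matrix (Fin 2) (Fin 2) R,
      H * K = 1 ∧ K * H = 1 ∧ K * F * H = Matrix.diagonal ![1, 0] := by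
  obtain rfl : F = !![u 0 * v 0, u 0 * v 1; u 1 * v 0, u 1 * v 1] := by
    ext i j
    fin_cases i <;> fin_cases j <;> exact hF _ _
  refine ⟨!![u 0, -v 1; u 1, v 0], !![v 0, v 1; -u 1, u 0], ?_, ?_, ?_⟩
  · ext i j
    fin_cases i <;> fin_cases j <;> simp <;> first | ring1 | linear_combination huv
  · ext i j
    fin_cases i <;> fin_cases j <;> simp <;> first | ring1 | linear_combination huv
  · ext i j
    fin_cases i <;> fin_cases j <;> simp <;>
      first | ring1 | linear_combination (u 0 * v 0 + u 1 * v 1 + 1) * huv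

/-- Every `2 × 2` idempotent matrix `F` over `H^∞(𝔻 × ℕ)` of constant
rank `1` is similar, by a matrix invertible over `H^∞(𝔻 × ℕ)`, to `diag(1, 0)`. -/
theorem idempotent_similar_diag_diskNat
    (F : Matrix (Fin 2) (Fin 2) HinfDiskNat)
    (hidem : F * F = F)
    (hrank : ∀ x : DiskNat, (valueMatrixDiskNat F x).rank = 1) :
    ∃ H K : Matrix (Fin 2) (Fin 2) HinfDiskNat,
      H * K = 1 ∧ K * H = 1 ∧
      K * F * H = Matrix.diagonal ![1, 0] := by
  have hmat : ∀ x, valueMatrixDiskNat F x * valueMatrixDiskNat F x = valueMatrixDiskNat F x := by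
    intro x
    ext i j
    have h := congrArg (fun f : HinfDiskNat => (f : DiskNat →ᵇ ℂ) x) (congrFun₂ hidem i j)
    simpa [valueMatrixDiskNat, Matrix.mul_apply, Fin.sum_univ_two] using h
  have htr : ∀ x, (valueMatrixDiskNat F x).trace = 1 := fun x =>
    Matrix.trace_eq_one_of_mul_self_of_rank_eq_one (hmat x) (hrank x)
  choose G hG hFG using fun i j => (F i j).2
  let M : ℝ := ∑ i, ∑ j, ‖(F i j : DiskNat →ᵇ ℂ)‖
  have hM : ∀ x i j, ‖(F i j : DiskNat →ᵇ ℂ) x‖ ≤ M := fun x i j =>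
    (BoundedContinuousFunction.norm_coe_le_norm _ x).trans <|
      (Finset.single_le_sum (f := fun j => ‖(F i j : DiskNat →ᵇ ℂ)‖)
        (fun _ _ => norm_nonneg _) (Finset.mem_univ j)).trans <|
      Finset.single_le_sum (f := fun i => ∑ j, ‖(F i j : DiskNat →ᵇ ℂ)‖)
        (fun _ _ => Finset.sum_nonneg fun _ _ => norm_nonneg _) (Finset.mem_univ i)
  have hval : ∀ (n : ℕ) (z : unitDisk),
      (Matrix.of fun i j => G i j n z) = valueMatrixDiskNat F (z, n) := fun n z => by
    ext i j
    exact (hFG i j n z).symm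
  have hfac := fun n => exists_bounded_factorization_on_unitDisk
    (A := fun z => Matrix.of fun i j => G i j n z) (fun i j => hG i j n)
    (fun z hz => by rw [hval n ⟨z, hz⟩, hmat]) (fun z hz => by rw [hval n ⟨z, hz⟩, htr])
    (M := M) (fun z hz i j => by
      rw [Matrix.of_apply, ← hFG i j n ⟨z, hz⟩]
      exact hM _ i j)
  choose u v hu hv huv using hfac
  choose p hp using fun i => exists_mem_hinfDiskNat (f := fun n z => u n z i)
    (fun n => differentiableOn_pi.1 (hu n) i)
    (fun n z hz => (norm_le_pi_norm _ i).trans (huv n z hz).1)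
  choose q hq using fun i => exists_mem_hinfDiskNat (f := fun n z => v n z i)
    (fun n => differentiableOn_pi.1 (hv n) i)
    (fun n z hz => (norm_le_pi_norm _ i).trans (huv n z hz).2.1)
  have hF : ∀ i j, F i j = p i * q j := fun i j => by
    ext ⟨z, n⟩
    simpa [hp, hq, hFG] using (huv n z z.2).2.2 i j
  refine exists_similar_diagonal_of_eq_mul p q hF ?_
  rw [← hF, ← hF]
  ext x
  simpa [valueMatrixDiskNat, Matrix.trace_fin_two] using htr x

end
end
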